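/- Let a, b, c, t be real numbers with a ≥ 0, b > 0, c > 0, b² ≥ a·c, and 0 ≤ t < 1. Then (t·a + (1−t)·b)² · c ≤ b² · (t²·a + 2·t·(1−t)·b + (1−t)²·c). Equivalently, setting ℓ = t²·a + 2·t·(1−t)·b + (1−t)²·c (which is positive), one has (t·a + (1−t)·b)² / ℓ ≤ b² / c. -/

import Mathlib

/-- The key numerical inequality `(K_X·L)²/L² ≤ (K_X·H₀)²/H₀²` for
`L = t·K_X + (1-t)·H₀`, `0 ≤ t < 1`, where `a = K_X² ≥ 0`, `b = K_X·H₀ > 0`,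
`c = H₀² > 0` and the Hodge index theorem gives `b² ≥ a·c`.  Both the
cleared-denominator form and the quotient form are asserted. -/
theorem key_numerical_inequality (a b c t : ℝ)
    (ha : 0 ≤ a) (hb : 0 < b) (hc : 0 < c) (hodge : a * c ≤ b ^ 2)
    (ht0 : 0 ≤ t) (ht1 : t < 1) :
    (t * a + (1 - t) * b) ^ 2 * c
        ≤ b ^ 2 * (t ^ 2 * a + 2 * t * (1 - t) * b + (1 - t) ^ 2 * c) ∧
      (t * a + (1 - t) * b) ^ 2
          / (t ^ 2 * a + 2 * t * (1 - t) * b + (1 - t) ^ 2 * c)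
        ≤ b ^ 2 / c := by
  have hs : 0 < 1 - t := sub_pos.mpr ht1
  have hpos : 0 < t ^ 2 * a + 2 * t * (1 - t) * b + (1 - t) ^ 2 * c := by positivity
  have hprod : 0 ≤ (b ^ 2 - a * c) * (t ^ 2 * a + 2 * t * (1 - t) * b) :=
    mul_nonneg (sub_nonneg.mpr hodge) (by positivity)
  have key : (t * a + (1 - t) * b) ^ 2 * c
      ≤ b ^ 2 * (t ^ 2 * a + 2 * t * (1 - t) * b + (1 - t) ^ 2 * c) := by
    linear_combination hprod
  exact ⟨key, (div_le_div_iff₀ hpos hc).mpr key⟩
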